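/- Let H be a real Hilbert space, K ⊆ H nonempty closed convex with metric projection proj_K. For each k ≥ 1 let ψ⁽ᵏ⁾ : H → H be η-strongly monotone and L-Lipschitz (0 < η ≤ L), let 0 < ε < 2η/L², and set ρ = √(1 − 2εη + ε²L²) < 1. Suppose z*⁽ᵏ⁾ ∈ K satisfy z*⁽ᵏ⁾ = proj_K(z*⁽ᵏ⁾ − ε ψ⁽ᵏ⁾(z*⁽ᵏ⁾)) and ‖z*⁽ᵏ⁾ − z*⁽ᵏ⁻¹⁾‖ ≤ ω for all k. Suppose the iterates use inexact operators: z⁽ᵏ⁾ = proj_K(z⁽ᵏ⁻¹⁾ − ε ψ̂⁽ᵏ⁾(z⁽ᵏ⁻¹⁾)), where each ψ̂⁽ᵏ⁾ : H → H satisfies ‖ψ̂⁽ᵏ⁾(z) − ψ⁽ᵏ⁾(z)‖ ≤ e for all z ∈ H. Then limsup_{k→∞} ‖z⁽ᵏ⁾ − z*⁽ᵏ⁾‖ ≤ (ε e + ω)/(1 − ρ). -/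

import Mathlib

open scoped RealInnerProductSpace

section

variable {H : Type*} [NormedAddCommGroup H] [InnerProductSpace ℝ H]

theorem inner_sub_nearest_point_nonpos {K : Set H} (hK : Convex ℝ K) {x p : H} (hp : p ∈ K)
    (hmin : ∀ y ∈ K, ‖x - p‖ ≤ ‖x - y‖) {w : H} (hw : w ∈ K) : ⟪x - p, w - p⟫ ≤ 0 := by
  have : Nonempty K := ⟨⟨p, hp⟩⟩
  refine (norm_eq_iInf_iff_real_inner_le_zero hK hp).1 (le_antisymm ?_ ?_) w hw
  · exact le_ciInf fun y => hmin y y.2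
  · exact ciInf_le ⟨0, by rintro _ ⟨y, rfl⟩; exact norm_nonneg _⟩ (⟨p, hp⟩ : K)

/-- Metric projections onto convex sets are nonexpansive. -/
theorem norm_proj_sub_proj_le {K : Set H} (hK : Convex ℝ K) {P : H → H} (hmem : ∀ x, P x ∈ K)
    (hmin : ∀ x, ∀ y ∈ K, ‖x - P x‖ ≤ ‖x - y‖) (x y : H) : ‖P x - P y‖ ≤ ‖x - y‖ := by
  have h₁ := inner_sub_nearest_point_nonpos hK (hmem x) (hmin x) (hmem y)
  have h₂ := inner_sub_nearest_point_nonpos hK (hmem y) (hmin y) (hmem x)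
  have h₃ : ⟪x - P x, P y - P x⟫ + ⟪y - P y, P x - P y⟫
      = ‖P x - P y‖ ^ 2 - ⟪x - y, P x - P y⟫ := by
    rw [← real_inner_self_eq_norm_sq, ← neg_sub (P x) (P y), inner_neg_right]
    simp only [inner_sub_left]
    ring
  have h₄ := real_inner_le_norm (x - y) (P x - P y)
  by_contra! h
  nlinarith [norm_nonneg (x - y)]

/-- A forward step along a strongly monotone Lipschitz operator is Lipschitz. -/
theorem norm_forward_step_sub_le {f : H → H} {η L ε : ℝ} (hε : 0 ≤ ε)
    (hmono : ∀ x y : H, η * ‖x - y‖ ^ 2 ≤ ⟪f x - f y, x - y⟫)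
    (hlip : ∀ x y : H, ‖f x - f y‖ ≤ L * ‖x - y‖) (x y : H) :
    ‖(x - ε • f x) - (y - ε • f y)‖
      ≤ Real.sqrt (1 - 2 * ε * η + ε ^ 2 * L ^ 2) * ‖x - y‖ := by
  have h_sq : ‖(x - ε • f x) - (y - ε • f y)‖ ^ 2
      ≤ (1 - 2 * ε * η + ε ^ 2 * L ^ 2) * ‖x - y‖ ^ 2 := by
    have h_eq : (x - ε • f x) - (y - ε • f y) = (x - y) - ε • (f x - f y) := by
      rw [smul_sub]; abel
    rw [h_eq, norm_sub_sq_real, inner_smul_right, norm_smul, Real.norm_eq_abs, mul_pow, sq_abs,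
      real_inner_comm]
    have h₁ := mul_le_mul_of_nonneg_left (hmono x y) hε
    have h₂ := mul_le_mul_of_nonneg_left
      (pow_le_pow_left₀ (norm_nonneg _) (hlip x y) 2) (sq_nonneg ε)
    linarith
  rw [← Real.sqrt_sq (norm_nonneg (x - y)), ← Real.sqrt_mul' _ (sq_nonneg _)]
  exact Real.le_sqrt_of_sq_le h_sq

end

theorem limsup_le_of_affine_contraction {a : ℕ → ℝ} {ρ b : ℝ} (ha : ∀ k, 0 ≤ a k) (hρ₀ : 0 ≤ ρ)
    (hρ₁ : ρ < 1) (hstep : ∀ k, a (k + 1) ≤ ρ * a k + b) :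
    Filter.limsup a Filter.atTop ≤ b / (1 - ρ) := by
  set c := b / (1 - ρ) with hc
  have hb : b = c - ρ * c := by
    have : 1 - ρ ≠ 0 := by linarith
    rw [hc]; field_simp
  have hbound : ∀ k, a k ≤ c + ρ ^ k * (a 0 - c) := by
    intro k
    induction k with
    | zero => simp
    | succ k ih =>
      have h := mul_le_mul_of_nonneg_left ih hρ₀
      rw [pow_succ]
      linarith [hstep k]
  have hlim : Filter.Tendsto (fun k : ℕ => c + ρ ^ k * (a 0 - c)) Filter.atTop (nhds c) := by
    simpa using
      ((tendsto_pow_atTop_nhds_zero_of_lt_one hρ₀ hρ₁).mul_const (a 0 - c)).const_add c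
  rw [← hlim.limsup_eq]
  exact Filter.limsup_le_limsup (Filter.Eventually.of_forall hbound)
    (Filter.isCoboundedUnder_le_of_le _ ha) hlim.isBoundedUnder_le

/-- Tracking theorem for ZOIO in the time-varying setting: projected iterates driven by
inexact operators `ψ̂⁽ᵏ⁾` with uniform error `e` track the time-varying fixed points
`z*⁽ᵏ⁾` up to the asymptotic error `(εe + ω)/(1 − ρ)`. -/
theorem zoio_time_varying_tracking
    {H : Type*} [NormedAddCommGroup H] [InnerProductSpace ℝ H] [CompleteSpace H]
    (K : Set H) (hK_ne : K.Nonempty) (hK_closed : IsClosed K) (hK_convex : Convex ℝ K)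
    (projK : H → H)
    (hprojK_mem : ∀ x, projK x ∈ K)
    (hprojK_dist : ∀ x, ∀ y ∈ K, ‖x - projK x‖ ≤ ‖x - y‖)
    (ψ : ℕ → H → H) (η L : ℝ) (hη : 0 < η) (hηL : η ≤ L)
    (hmono : ∀ k ≥ 1, ∀ z z' : H, η * ‖z - z'‖ ^ 2 ≤ ⟪ψ k z - ψ k z', z - z'⟫)
    (hlip : ∀ k ≥ 1, ∀ z z' : H, ‖ψ k z - ψ k z'‖ ≤ L * ‖z - z'‖)
    (ε ρ : ℝ) (hε_pos : 0 < ε) (hε_lt : ε < 2 * η / L ^ 2)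
    (hρ : ρ = Real.sqrt (1 - 2 * ε * η + ε ^ 2 * L ^ 2))
    (zStar : ℕ → H) (ω : ℝ)
    (hzStar_mem : ∀ k, zStar k ∈ K)
    (hfix : ∀ k ≥ 1, zStar k = projK (zStar k - ε • ψ k (zStar k)))
    (hdrift : ∀ k ≥ 1, ‖zStar k - zStar (k - 1)‖ ≤ ω)
    (ψhat : ℕ → H → H) (e : ℝ)
    (herr : ∀ k ≥ 1, ∀ z : H, ‖ψhat k z - ψ k z‖ ≤ e)
    (z : ℕ → H)
    (hupdate : ∀ k ≥ 1, z k = projK (z (k - 1) - ε • ψhat k (z (k - 1)))) :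
    Filter.limsup (fun k => ‖z k - zStar k‖) Filter.atTop ≤ (ε * e + ω) / (1 - ρ) := by
  have hρ₀ : 0 ≤ ρ := hρ ▸ Real.sqrt_nonneg _
  have hρ₁ : ρ < 1 := by
    have hL : 0 < L := hη.trans_le hηL
    rw [lt_div_iff₀ (by positivity)] at hε_lt
    rw [hρ, Real.sqrt_lt' one_pos]
    nlinarith
  have hω : 0 ≤ ω := (norm_nonneg _).trans (hdrift 1 le_rfl)
  refine limsup_le_of_affine_contraction (fun k => norm_nonneg _) hρ₀ hρ₁ fun k => ?_
  have hk : k + 1 ≥ 1 := Nat.le_add_left 1 k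
  have hz := hupdate (k + 1) hk
  have hd := hdrift (k + 1) hk
  rw [Nat.add_sub_cancel] at hz hd
  have h_nonexp : ‖z (k + 1) - zStar (k + 1)‖ ≤ ‖(z k - ε • ψhat (k + 1) (z k))
      - (zStar (k + 1) - ε • ψ (k + 1) (zStar (k + 1)))‖ := by
    conv_lhs => rw [hz, hfix (k + 1) hk]
    exact norm_proj_sub_proj_le hK_convex hprojK_mem hprojK_dist _ _
  have h_split : (z k - ε • ψhat (k + 1) (z k))
      - (zStar (k + 1) - ε • ψ (k + 1) (zStar (k + 1)))
      = ((z k - ε • ψ (k + 1) (z k)) - (zStar (k + 1) - ε • ψ (k + 1) (zStar (k + 1))))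
        - ε • (ψhat (k + 1) (z k) - ψ (k + 1) (z k)) := by
    rw [smul_sub]; abel
  have h_forward := norm_forward_step_sub_le hε_pos.le (hmono (k + 1) hk) (hlip (k + 1) hk)
    (z k) (zStar (k + 1))
  rw [← hρ] at h_forward
  have h_err : ‖ε • (ψhat (k + 1) (z k) - ψ (k + 1) (z k))‖ ≤ ε * e := by
    rw [norm_smul, Real.norm_of_nonneg hε_pos.le]
    exact mul_le_mul_of_nonneg_left (herr (k + 1) hk (z k)) hε_pos.le
  have h_drift : ‖z k - zStar (k + 1)‖ ≤ ‖z k - zStar k‖ + ω := by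
    rw [norm_sub_rev] at hd
    exact (norm_sub_le_norm_sub_add_norm_sub _ (zStar k) _).trans (by gcongr)
  rw [h_split] at h_nonexp
  have h_tri := h_nonexp.trans (norm_sub_le _ _)
  have h_contr := mul_le_mul_of_nonneg_left h_drift hρ₀
  nlinarith
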